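/- Let 0 < α < β < ∞. There is a set G₁ ⊆ [0,1] of full Lebesgue measure such that for every ω ∈ G₁, limsup_{n→∞} n^{1/α} x_n(ω) ≤ (α 2^α p₁)^{-1/α} = (1/2)(α p₁)^{-1/α}. -/

import Mathlib

open MeasureTheory Filter Set Topology

noncomputable section

/-- The Liverani–Saussol–Vaienti map `T_a` on `[0,1]`. -/
def lsv (a x : ℝ) : ℝ := if x ≤ 1 / 2 then x * (1 + (2 : ℝ) ^ a * x ^ a) else 2 * x - 1

/-- Random parameter selection: `α` on `[0,p₁)`, `β` on `[p₁,1]`. -/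
def alphaOf (α β p₁ ω : ℝ) : ℝ := if ω < p₁ then α else β

/-- The noise dynamics `φ` on `[0,1]`. -/
def phiMap (p₁ ω : ℝ) : ℝ := if ω < p₁ then ω / p₁ else (ω - p₁) / (1 - p₁)

/-- The skew product `S(x,ω) = (T_{α(ω)} x, φ ω)`. -/
def skewLSV (α β p₁ : ℝ) (p : ℝ × ℝ) : ℝ × ℝ :=
  (lsv (alphaOf α β p₁ p.2) p.1, phiMap p₁ p.2)

/-- The base of inducing, `Δ₀ = (1/2,1] × [0,1]`. -/
def Δ0 : Set (ℝ × ℝ) := Ioc (1 / 2 : ℝ) 1 ×ˢ Icc (0 : ℝ) 1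

/-- The fixed probability space of the noise: Lebesgue measure on `[0,1]`. -/
def unitMeasure : Measure ℝ := volume.restrict (Icc 0 1)

instance : IsProbabilityMeasure unitMeasure :=
  ⟨by simp [unitMeasure]⟩

/-- The set of noise points at which the parameter `α` is selected. -/
def lowSet (p₁ : ℝ) : Set ℝ := Iio p₁

lemma measurableSet_lowSet (p₁ : ℝ) : MeasurableSet (lowSet p₁) := measurableSet_Iio

lemma measurable_phiMap (p₁ : ℝ) : Measurable (phiMap p₁) := by
  unfold phiMap
  exact Measurable.ite measurableSet_Iio (by fun_prop) (by fun_prop)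

lemma unitMeasure_lowSet_inter {p₁ : ℝ} (hp₁ : 0 < p₁) (hp₁' : p₁ < 1) {B : Set ℝ}
    (hB : MeasurableSet B) :
    unitMeasure (lowSet p₁ ∩ phiMap p₁ ⁻¹' B) = ENNReal.ofReal p₁ * unitMeasure B := by
  have hset : (lowSet p₁ ∩ phiMap p₁ ⁻¹' B) ∩ Icc 0 1 =
      (fun x => p₁⁻¹ * x) ⁻¹' (B ∩ Ico 0 1) := by
    ext x
    simp only [lowSet, phiMap, mem_inter_iff, mem_Iio, mem_preimage, mem_Icc, mem_Ico,
      inv_mul_eq_div, div_lt_one hp₁]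
    constructor
    · rintro ⟨⟨hx, hxB⟩, hx0, -⟩
      rw [if_pos hx] at hxB
      exact ⟨hxB, by positivity, hx⟩
    · rintro ⟨hxB, hx0, hx⟩
      have : 0 ≤ x := by simpa [hp₁.ne'] using mul_nonneg hx0 hp₁.le
      rw [if_pos hx]
      exact ⟨⟨hx, hxB⟩, this, by linarith⟩
  have hIco : volume (B ∩ Ico (0 : ℝ) 1) = volume (B ∩ Icc 0 1) :=
    measure_congr ((ae_eq_refl B).inter Ico_ae_eq_Icc)
  rw [unitMeasure, Measure.restrict_apply ((measurableSet_lowSet p₁).inter (measurable_phiMap p₁ hB)),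
    hset, Real.volume_preimage_mul_left (inv_pos.2 hp₁).ne', Measure.restrict_apply hB, hIco,
    inv_inv, abs_of_pos hp₁]

lemma unitMeasure_compl_lowSet_inter {p₁ : ℝ} (hp₁ : 0 < p₁) (hp₁' : p₁ < 1) {B : Set ℝ}
    (hB : MeasurableSet B) :
    unitMeasure ((lowSet p₁)ᶜ ∩ phiMap p₁ ⁻¹' B) =
      ENNReal.ofReal (1 - p₁) * unitMeasure B := by
  have hq : 0 < 1 - p₁ := by linarith
  have hset : ((lowSet p₁)ᶜ ∩ phiMap p₁ ⁻¹' B) ∩ Icc 0 1 =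
      (fun x => x + -p₁) ⁻¹' ((fun x => (1 - p₁)⁻¹ * x) ⁻¹' (B ∩ Icc 0 1)) := by
    ext x
    simp only [lowSet, phiMap, mem_inter_iff, mem_compl_iff, mem_Iio, not_lt, mem_preimage,
      mem_Icc, inv_mul_eq_div, div_le_one hq, ← sub_eq_add_neg]
    constructor
    · rintro ⟨⟨hx, hxB⟩, -, hx1⟩
      rw [if_neg hx.not_gt] at hxB
      exact ⟨hxB, div_nonneg (by linarith) hq.le, by linarith⟩
    · rintro ⟨hxB, hx0, hx1⟩
      have : 0 ≤ x - p₁ := by simpa [hq.ne'] using mul_nonneg hx0 hq.le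
      rw [if_neg (by linarith)]
      exact ⟨⟨by linarith, hxB⟩, by linarith, by linarith⟩
  rw [unitMeasure,
    Measure.restrict_apply ((measurableSet_lowSet p₁).compl.inter (measurable_phiMap p₁ hB)),
    hset,
    measure_preimage_add_right, Real.volume_preimage_mul_left (inv_pos.2 hq).ne',
    Measure.restrict_apply hB, inv_inv, abs_of_pos hq]

lemma measurePreserving_phiMap {p₁ : ℝ} (hp₁ : 0 < p₁) (hp₁' : p₁ < 1) :
    MeasurePreserving (phiMap p₁) unitMeasure unitMeasure := by
  refine ⟨measurable_phiMap p₁, Measure.ext fun B hB => ?_⟩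
  rw [Measure.map_apply (measurable_phiMap p₁) hB,
    ← measure_inter_add_sdiff (phiMap p₁ ⁻¹' B) (measurableSet_lowSet p₁),
    inter_comm, sdiff_eq, inter_comm (phiMap p₁ ⁻¹' B), unitMeasure_lowSet_inter hp₁ hp₁' hB,
    unitMeasure_compl_lowSet_inter hp₁ hp₁' hB, ← add_mul,
    ← ENNReal.ofReal_add hp₁.le (by linarith)]
  simp

lemma unitMeasure_lowSet {p₁ : ℝ} (hp₁ : 0 < p₁) (hp₁' : p₁ < 1) :
    unitMeasure (lowSet p₁) = ENNReal.ofReal p₁ := by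
  simpa using unitMeasure_lowSet_inter hp₁ hp₁' MeasurableSet.univ

/-- The indicator that `α` is selected at time `j`. -/
def lowIndicator (p₁ : ℝ) (j : ℕ) : ℝ → ℝ :=
  (lowSet p₁).indicator 1 ∘ (phiMap p₁)^[j]

lemma measurable_indicator_lowSet (p₁ : ℝ) :
    Measurable ((lowSet p₁).indicator (1 : ℝ → ℝ)) :=
  measurable_one.indicator (measurableSet_lowSet p₁)

lemma measurable_lowIndicator (p₁ : ℝ) (j : ℕ) : Measurable (lowIndicator p₁ j) :=
  (measurable_indicator_lowSet p₁).comp ((measurable_phiMap p₁).iterate j)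

lemma indepFun_indicator_lowSet_phiMap {p₁ : ℝ} (hp₁ : 0 < p₁) (hp₁' : p₁ < 1) :
    ProbabilityTheory.IndepFun ((lowSet p₁).indicator (1 : ℝ → ℝ)) (phiMap p₁) unitMeasure := by
  rw [ProbabilityTheory.indepFun_iff_measure_inter_preimage_eq_mul]
  intro s t _ ht
  rw [(measurePreserving_phiMap hp₁ hp₁').measure_preimage ht.nullMeasurableSet]
  rcases indicator_one_preimage (M := ℝ) (lowSet p₁) s with h | h | h | h <;> rw [h]
  · rw [univ_inter, measure_univ, one_mul,
      (measurePreserving_phiMap hp₁ hp₁').measure_preimage ht.nullMeasurableSet]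
  · rw [unitMeasure_lowSet_inter hp₁ hp₁' ht, unitMeasure_lowSet hp₁ hp₁']
  · rw [unitMeasure_compl_lowSet_inter hp₁ hp₁' ht, prob_compl_eq_one_sub (measurableSet_lowSet p₁),
      unitMeasure_lowSet hp₁ hp₁', ENNReal.ofReal_sub _ hp₁.le, ENNReal.ofReal_one]
  · simp

lemma indepFun_lowIndicator_of_lt {p₁ : ℝ} (hp₁ : 0 < p₁) (hp₁' : p₁ < 1) {i j : ℕ}
    (hij : i < j) :
    ProbabilityTheory.IndepFun (lowIndicator p₁ i) (lowIndicator p₁ j) unitMeasure := by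
  obtain ⟨k, rfl⟩ := Nat.exists_eq_add_of_lt hij
  have h := (indepFun_indicator_lowSet_phiMap hp₁ hp₁').comp measurable_id
    (measurable_lowIndicator p₁ k)
  have hmp := (measurePreserving_phiMap hp₁ hp₁').iterate i
  have hj : lowIndicator p₁ (i + k + 1) = (lowIndicator p₁ k ∘ phiMap p₁) ∘ (phiMap p₁)^[i] := by
    rw [lowIndicator, lowIndicator, show i + k + 1 = k + 1 + i by ring, Function.iterate_add,
      Function.iterate_succ]
    rfl
  rw [ProbabilityTheory.indepFun_iff_measure_inter_preimage_eq_mul] at h ⊢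
  intro s t hs ht
  have hs' := (measurable_indicator_lowSet p₁ hs).nullMeasurableSet (μ := unitMeasure)
  have ht' := (((measurable_lowIndicator p₁ k).comp (measurable_phiMap p₁)) ht).nullMeasurableSet
    (μ := unitMeasure)
  rw [hj, lowIndicator, preimage_comp, preimage_comp (g := lowIndicator p₁ k ∘ phiMap p₁),
    ← preimage_inter, hmp.measure_preimage (hs'.inter ht'), hmp.measure_preimage hs',
    hmp.measure_preimage ht']
  exact h s t hs ht

lemma ae_tendsto_lowIndicator {p₁ : ℝ} (hp₁ : 0 < p₁) (hp₁' : p₁ < 1) :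
    ∀ᵐ ω ∂unitMeasure, Tendsto
      (fun n : ℕ => (∑ j ∈ Finset.range n, lowIndicator p₁ j ω) / n) atTop (𝓝 p₁) := by
  have hmeas := measurable_indicator_lowSet p₁
  have hint : Integrable (lowIndicator p₁ 0) unitMeasure :=
    (integrable_const (1 : ℝ)).indicator (measurableSet_lowSet p₁)
  have hmean : ∫ ω, lowIndicator p₁ 0 ω ∂unitMeasure = p₁ := by
    have : lowIndicator p₁ 0 = (lowSet p₁).indicator 1 := rfl
    rw [this, integral_indicator_one (measurableSet_lowSet p₁), Measure.real,
      unitMeasure_lowSet hp₁ hp₁', ENNReal.toReal_ofReal hp₁.le]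
  have hlaw := ProbabilityTheory.strong_law_ae_real (lowIndicator p₁) hint
    (fun i j hij => hij.lt_or_gt.elim (indepFun_lowIndicator_of_lt hp₁ hp₁')
      fun h => (indepFun_lowIndicator_of_lt hp₁ hp₁' h).symm)
    (fun j => ?_)
  · rwa [hmean] at hlaw
  · have hmp := (measurePreserving_phiMap hp₁ hp₁').iterate j
    refine ⟨(measurable_lowIndicator p₁ j).aemeasurable,
      (measurable_lowIndicator p₁ 0).aemeasurable, ?_⟩
    rw [lowIndicator, ← Measure.map_map hmeas hmp.measurable, hmp.map_eq]
    rfl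

/-- Along any noise path, the rescaled backward orbit falls below `δ` after a time that depends
only on `δ`. -/
lemma exists_forall_le_of_recursion {α β p₁ : ℝ} (hα : 0 < α) (hαβ : α < β)
    {Y : ℕ → ℝ → ℝ} (hpos : ∀ n ω, 0 < Y n ω) (hle : ∀ n ω, Y n ω ≤ 1)
    (hY : ∀ n ω, Y (n + 1) ω * (1 + Y (n + 1) ω ^ alphaOf α β p₁ ω) = Y n (phiMap p₁ ω))
    {δ : ℝ} (hδ : 0 < δ) : ∃ K, ∀ n, K ≤ n → ∀ ω, Y n ω ≤ δ := by
  have hs : 0 < δ ^ β := by positivity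
  have hr1 : (1 + δ ^ β)⁻¹ < 1 := inv_lt_one_of_one_lt₀ (by linarith)
  have hr0 : 0 < (1 + δ ^ β)⁻¹ := by positivity
  have key : ∀ n ω, Y n ω ≤ max δ ((1 + δ ^ β)⁻¹ ^ n) := by
    intro n
    induction n with
    | zero => intro ω; simpa using Or.inr (hle 0 ω)
    | succ n ih =>
      intro ω
      have hy := hpos (n + 1) ω
      have hrec := hY n ω
      by_cases hd : Y (n + 1) ω ≤ δ
      · exact le_max_of_le_left hd
      push Not at hd
      have hpow : δ ^ β ≤ Y (n + 1) ω ^ alphaOf α β p₁ ω :=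
        calc δ ^ β ≤ Y (n + 1) ω ^ β := Real.rpow_le_rpow hδ.le hd.le (by linarith)
          _ ≤ _ := Real.rpow_le_rpow_of_exponent_ge hy (hle _ _)
            (by unfold alphaOf; split_ifs <;> linarith)
      have hmul : Y (n + 1) ω * (1 + δ ^ β) ≤ Y n (phiMap p₁ ω) := by
        rw [← hrec]; gcongr
      have hlt : δ < Y n (phiMap p₁ ω) := by nlinarith [mul_pos hy hs]
      have hn : Y n (phiMap p₁ ω) ≤ (1 + δ ^ β)⁻¹ ^ n :=
        (le_max_iff.1 (ih (phiMap p₁ ω))).resolve_left hlt.not_ge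
      refine le_max_of_le_right ?_
      rw [pow_succ, ← div_eq_mul_inv, le_div_iff₀ (by positivity)]
      exact hmul.trans hn
  obtain ⟨K, hK⟩ := exists_pow_lt_of_lt_one hδ hr1
  refine ⟨K, fun n hn ω => (key n ω).trans (max_le le_rfl ?_)⟩
  exact (pow_le_pow_of_le_one hr0.le hr1.le hn).trans hK.le

/-- Near the neutral fixed point, one backward `α`-step raises `y ^ (-α)` by almost `α`. -/
lemma exists_forall_add_le_rpow_neg {α c : ℝ} (hα : 0 < α) (hc : c < α) :
    ∃ δ > 0, ∀ y, 0 < y → y ≤ δ → (y * (1 + y ^ α)) ^ (-α) + c ≤ y ^ (-α) := by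
  have hd : HasDerivAt (fun t : ℝ => (1 + t) ^ (-α)) (-α) 0 := by
    have h := ((hasDerivAt_id (0 : ℝ)).const_add 1).rpow_const (p := -α) (Or.inl (by simp))
    simpa using h
  have hslope := (hasDerivAt_iff_tendsto_slope_zero.1 hd).mono_left
    (nhdsWithin_mono (0 : ℝ) (fun x (hx : x ∈ Ioi 0) => ne_of_gt hx))
  have hev := hslope.eventually (gt_mem_nhds (neg_lt_neg hc))
  obtain ⟨t₀, ht₀, hsub⟩ := mem_nhdsGT_iff_exists_Ioo_subset.1 hev
  have ht₀' : (0 : ℝ) < t₀ := ht₀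
  refine ⟨(t₀ / 2) ^ α⁻¹, by positivity, fun y hy hyδ => ?_⟩
  have ht : 0 < y ^ α := by positivity
  have htle : y ^ α ≤ t₀ / 2 := by
    calc y ^ α ≤ ((t₀ / 2) ^ α⁻¹) ^ α := Real.rpow_le_rpow hy.le hyδ hα.le
      _ = t₀ / 2 := Real.rpow_inv_rpow (by positivity) hα.ne'
  have h : (y ^ α)⁻¹ * ((1 + y ^ α) ^ (-α) - 1) < -c := by
    simpa using hsub (show y ^ α ∈ Ioo 0 t₀ from ⟨ht, by linarith⟩)
  rw [Real.mul_rpow hy.le (by positivity), Real.rpow_neg hy.le]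
  nlinarith

lemma sum_lowIndicator_succ (p₁ : ℝ) (m : ℕ) (ω : ℝ) :
    ∑ j ∈ Finset.range (m + 1), lowIndicator p₁ j ω =
      ∑ j ∈ Finset.range m, lowIndicator p₁ j (phiMap p₁ ω) + (lowSet p₁).indicator 1 ω := by
  rw [Finset.sum_range_succ']
  rfl

lemma mul_sum_lowIndicator_le {α β p₁ c : ℝ} (hα : 0 < α)
    {Y : ℕ → ℝ → ℝ} (hpos : ∀ n ω, 0 < Y n ω)
    (hY : ∀ n ω, Y (n + 1) ω * (1 + Y (n + 1) ω ^ alphaOf α β p₁ ω) = Y n (phiMap p₁ ω))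
    {δ : ℝ} (hδ : ∀ y, 0 < y → y ≤ δ → (y * (1 + y ^ α)) ^ (-α) + c ≤ y ^ (-α))
    {K : ℕ} (hK : ∀ n, K ≤ n → ∀ ω, Y n ω ≤ δ) (m : ℕ) (ω : ℝ) :
    c * ∑ j ∈ Finset.range m, lowIndicator p₁ j ω ≤ Y (m + K) ω ^ (-α) := by
  induction m generalizing ω with
  | zero => simpa using Real.rpow_nonneg (hpos _ _).le _
  | succ m ih =>
    have hy := hpos (m + K + 1) ω
    have hrec := hY (m + K) ω
    have hih := ih (phiMap p₁ ω)
    rw [sum_lowIndicator_succ, mul_add, add_right_comm m 1 K]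
    by_cases hω : ω < p₁
    · have hstep := hδ _ hy (hK (m + K + 1) (by omega) ω)
      rw [alphaOf, if_pos hω] at hrec
      rw [hrec] at hstep
      rw [indicator_of_mem (show ω ∈ lowSet p₁ from hω)]
      simp only [Pi.one_apply, mul_one]
      linarith
    · rw [indicator_of_notMem (show ω ∉ lowSet p₁ from hω), mul_zero, add_zero]
      refine hih.trans (Real.rpow_le_rpow_of_nonpos hy ?_ (by linarith))
      rw [← hrec]
      exact le_mul_of_one_le_right hy.le (by linarith [Real.rpow_nonneg hy.le (alphaOf α β p₁ ω)])

lemma eventually_mul_le_rpow_neg {α β p₁ d : ℝ} (hα : 0 < α) (hαβ : α < β) (hp₁ : 0 < p₁)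
    {Y : ℕ → ℝ → ℝ} (hpos : ∀ n ω, 0 < Y n ω) (hle : ∀ n ω, Y n ω ≤ 1)
    (hY : ∀ n ω, Y (n + 1) ω * (1 + Y (n + 1) ω ^ alphaOf α β p₁ ω) = Y n (phiMap p₁ ω))
    (hd : d < α * p₁) {ω : ℝ}
    (hω : Tendsto (fun n : ℕ => (∑ j ∈ Finset.range n, lowIndicator p₁ j ω) / n) atTop (𝓝 p₁)) :
    ∀ᶠ n : ℕ in atTop, d * (n + 1) ≤ Y n ω ^ (-α) := by
  obtain ⟨c, hdc, hcα⟩ := exists_between ((div_lt_iff₀ hp₁).2 hd)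
  obtain ⟨δ, hδ, hstep⟩ := exists_forall_add_le_rpow_neg hα hcα
  obtain ⟨K, hK⟩ := exists_forall_le_of_recursion hα hαβ hpos hle hY hδ
  rw [← map_add_atTop_eq_nat K, eventually_map]
  have hlim : Tendsto (fun m : ℕ => c * ((∑ j ∈ Finset.range m, lowIndicator p₁ j ω) / m)
      - d * (K + 1) / m) atTop (𝓝 (c * p₁ - 0)) :=
    (hω.const_mul c).sub (tendsto_const_div_atTop_nhds_zero_nat _)
  have hlt : d < c * p₁ - 0 := by rw [sub_zero]; exact (div_lt_iff₀ hp₁).1 hdc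
  filter_upwards [hlim.eventually (lt_mem_nhds hlt), eventually_gt_atTop 0] with m hm hm0
  have hm0' : (0 : ℝ) < m := by exact_mod_cast hm0
  refine le_trans ?_ (mul_sum_lowIndicator_le hα hpos hY hstep hK m ω)
  rw [← mul_div_assoc, ← sub_div, lt_div_iff₀ hm0'] at hm
  push_cast
  linarith

/-- Lemma 2.3: there is a full-measure set `G₁ ⊆ [0,1]` on which
`limsup n^{1/α} x_n(ω) ≤ (α 2^α p₁)^{-1/α} = (1/2)(α p₁)^{-1/α}`. -/
theorem limsup_upper_bound (α β p₁ : ℝ) (hα : 0 < α) (hαβ : α < β)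
    (hp₁ : 0 < p₁) (hp₁' : p₁ < 1)
    (X : ℕ → ℝ → ℝ) (hX1 : ∀ ω, X 1 ω = 1 / 2)
    (hX : ∀ n, 2 ≤ n → ∀ ω, X n ω ∈ Ioc (0 : ℝ) (1 / 2) ∧
      lsv (alphaOf α β p₁ ω) (X n ω) = X (n - 1) (phiMap p₁ ω)) :
    (∃ G₁ : Set ℝ, G₁ ⊆ Icc (0 : ℝ) 1 ∧ volume G₁ = 1 ∧
      ∀ ω ∈ G₁,
        Filter.limsup (fun n : ℕ => (n : ℝ) ^ (1 / α) * X n ω) atTop ≤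
          (α * (2 : ℝ) ^ α * p₁) ^ (-(1 / α))) ∧
    (α * (2 : ℝ) ^ α * p₁) ^ (-(1 / α)) = (1 / 2 : ℝ) * (α * p₁) ^ (-(1 / α)) := by
  have hclosed : (α * (2 : ℝ) ^ α * p₁) ^ (-(1 / α)) = (1 / 2 : ℝ) * (α * p₁) ^ (-(1 / α)) := by
    rw [mul_right_comm, mul_comm, Real.mul_rpow (by positivity) (by positivity),
      ← Real.rpow_mul (by norm_num), mul_neg, mul_one_div_cancel hα.ne', Real.rpow_neg_one,
      one_div 2]
  refine ⟨?_, hclosed⟩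
  rw [hclosed]
  set Y : ℕ → ℝ → ℝ := fun n ω => 2 * X (n + 1) ω with hYdef
  have hXmem : ∀ n ω, X (n + 1) ω ∈ Ioc (0 : ℝ) (1 / 2) := by
    intro n ω
    rcases n with _ | n
    · rw [zero_add, hX1]; norm_num
    · exact (hX (n + 2) (by omega) ω).1
  have hpos : ∀ n ω, 0 < Y n ω := fun n ω => mul_pos two_pos (hXmem n ω).1
  have hle : ∀ n ω, Y n ω ≤ 1 := fun n ω => by
    have := (hXmem n ω).2
    simp only [hYdef]; linarith
  have hY : ∀ n ω, Y (n + 1) ω * (1 + Y (n + 1) ω ^ alphaOf α β p₁ ω) = Y n (phiMap p₁ ω) := by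
    intro n ω
    obtain ⟨hmem, hrec⟩ := hX (n + 2) (by omega) ω
    rw [lsv, if_pos hmem.2, show n + 2 - 1 = n + 1 from rfl] at hrec
    simp only [hYdef]
    rw [Real.mul_rpow two_pos.le hmem.1.le, ← hrec]
    ring
  refine ⟨{ω | Tendsto (fun n : ℕ => (∑ j ∈ Finset.range n, lowIndicator p₁ j ω) / n) atTop
    (𝓝 p₁)} ∩ Icc 0 1, inter_subset_right, ?_, fun ω hω => ?_⟩
  · have h := measure_congr (eventuallyEq_univ.2 (ae_tendsto_lowIndicator hp₁ hp₁'))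
    rwa [measure_univ, unitMeasure, Measure.restrict_apply' measurableSet_Icc] at h
  have hbound : ∀ d ∈ Ioo 0 (α * p₁),
      limsup (fun n : ℕ => (n : ℝ) ^ (1 / α) * X n ω) atTop ≤ 1 / 2 * d ^ (-(1 / α)) := by
    rintro d ⟨hd0, hd⟩
    have hev := eventually_mul_le_rpow_neg hα hαβ hp₁ hpos hle hY hd hω.1
    refine limsup_le_of_le ?_ ?_
    · refine isCoboundedUnder_le_of_eventually_le atTop (x := 0) ?_
      filter_upwards [eventually_ge_atTop 1] with n hn
      obtain ⟨k, rfl⟩ := Nat.exists_eq_add_of_le' hn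
      exact mul_nonneg (by positivity) (hXmem k ω).1.le
    · rw [← map_add_atTop_eq_nat 1, eventually_map]
      filter_upwards [hev] with n hn
      have hy := hpos n ω
      have h := Real.rpow_le_rpow_of_nonpos (z := -(1 / α)) (by positivity) hn
        (by rw [neg_nonpos]; positivity)
      rw [← Real.rpow_mul hy.le, neg_mul_neg, mul_one_div_cancel hα.ne', Real.rpow_one,
        Real.mul_rpow hd0.le (by positivity), Real.rpow_neg (by positivity : (0 : ℝ) ≤ n + 1),
        ← div_eq_mul_inv, le_div_iff₀ (by positivity)] at h
      simp only [hYdef] at h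
      push_cast
      linarith
  have hcont : ContinuousAt (fun d : ℝ => 1 / 2 * d ^ (-(1 / α))) (α * p₁) :=
    continuousAt_const.mul (Real.continuousAt_rpow_const _ _ (Or.inl (by positivity)))
  refine ge_of_tendsto (hcont.tendsto.mono_left (nhdsWithin_le_nhds (s := Iio (α * p₁)))) ?_
  filter_upwards [Ioo_mem_nhdsLT (show 0 < α * p₁ by positivity)] with d hd using hbound d hd
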